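/- Let (W, S) be a Coxeter system, (Q, φ) a maximal partial special matching with a = φ(e), and s ∈ S with s ≠ a. Then φ is s-regular on the left (i.e. Q is stable under x ↦ sx and φ(sx) = sφ(x) for all x ∈ Q) if and only if the restriction of φ to the principal dihedral subgroup P_s = ⟨s,a⟩ is s-regular on the left. -/

import Mathlib

open CoxeterSystem Polynomial

section CoxPre

variable {B : Type*} {W : Type*} [Group W] {M : CoxeterMatrix B}

/-- The alternating word of length `n` starting with the letter `i`
(and then alternating between `i` and `j`). -/
def altW (i j : B) : ℕ → List B
  | 0 => []
  | n + 1 => i :: altW j i n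

variable (cs : CoxeterSystem M W)

/-- The Bruhat order on a Coxeter group: the reflexive-transitive closure of the
relation `u → u * t` (`t` a reflection) when the length goes up. -/
def bruhatLE : W → W → Prop :=
  Relation.ReflTransGen
    (fun u v => ∃ t, cs.IsReflection t ∧ v = u * t ∧ cs.length u < cs.length v)

/-- The covering relation of the Bruhat order. -/
def bCov (u v : W) : Prop :=
  bruhatLE cs u v ∧ u ≠ v ∧ ∀ z, bruhatLE cs u z → bruhatLE cs z v → z = u ∨ z = v

/-- The set of coatoms of `v` in the Bruhat order. -/
def bCoat (v : W) : Set W := {x | bCov cs x v}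

/-- A partial special matching of `W` equipped with the Bruhat order: a Bruhat order
ideal `dom` together with an involution of it such that `u ⋖ φ u` or `φ u ⋖ u` for all
`u ∈ dom`, satisfying the coatom condition. -/
structure BSM where
  dom : Set W
  toFun : W → W
  ideal : ∀ ⦃x y : W⦄, y ∈ dom → bruhatLE cs x y → x ∈ dom
  maps : ∀ x ∈ dom, toFun x ∈ dom
  invol : ∀ x ∈ dom, toFun (toFun x) = x
  cov : ∀ x ∈ dom, bCov cs (toFun x) x ∨ bCov cs x (toFun x)
  coatom : ∀ u ∈ dom, bCov cs u (toFun u) →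
    bCoat cs (toFun u) =
      {u} ∪ {w | ∃ v, bCov cs v u ∧ bCov cs v (toFun v) ∧ w = toFun v}

/-- The standard dihedral subgroup `⟨s,t⟩` of `W`, as a set. -/
def dihedral (s t : B) : Set W :=
  (Subgroup.closure {cs.simple s, cs.simple t} : Subgroup W)

/-- `w` is full with respect to `J ⊆ S`: for all distinct `i, j ∈ J`, `m i j < ∞` and the
longest element of `⟨i,j⟩` is `≤ w` in Bruhat order. -/
def IsFullWrt (J : Set B) (w : W) : Prop :=
  ∀ i ∈ J, ∀ j ∈ J, i ≠ j →
    M i j ≠ 0 ∧ bruhatLE cs (cs.wordProd (altW i j (M i j))) w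

/-- The standard axioms characterizing the `R`-polynomials of the Hecke algebra of `W`. -/
def RAxioms (R : W → W → Polynomial ℤ) : Prop :=
  (∀ u, R u u = 1) ∧
  (∀ u v, ¬ bruhatLE cs u v → R u v = 0) ∧
  (∀ (i : B) (x y : W),
      cs.length (cs.simple i * x) = cs.length x + 1 →
      cs.length (cs.simple i * y) = cs.length y + 1 →
      R (cs.simple i * x) (cs.simple i * y) = R x y ∧
      R x (cs.simple i * y) = (X - 1) * R x y + X * R (cs.simple i * x) y) ∧
  (∀ (i : B) (x y : W),
      cs.length (x * cs.simple i) = cs.length x + 1 →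
      cs.length (y * cs.simple i) = cs.length y + 1 →
      R (x * cs.simple i) (y * cs.simple i) = R x y ∧
      R x (y * cs.simple i) = (X - 1) * R x y + X * R (x * cs.simple i) y)

variable {cs}

/-- `ψ` extends the partial special matching `φ`. -/
def BExtends (ψ φ : BSM cs) : Prop :=
  φ.dom ⊆ ψ.dom ∧ ∀ x ∈ φ.dom, ψ.toFun x = φ.toFun x

/-- `φ` is a maximal partial special matching. -/
def BMax (φ : BSM cs) : Prop := ∀ ψ : BSM cs, BExtends ψ φ → ψ.dom = φ.dom

/-- `φ` is `g`-regular on the left: its domain is stable under left multiplication by `g`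
and `φ` commutes with left multiplication by `g`. -/
def LeftReg (φ : BSM cs) (g : W) : Prop :=
  (∀ x ∈ φ.dom, g * x ∈ φ.dom) ∧ ∀ x ∈ φ.dom, φ.toFun (g * x) = g * φ.toFun x

/-- `φ` is `g`-regular on the right. -/
def RightReg (φ : BSM cs) (g : W) : Prop :=
  (∀ x ∈ φ.dom, x * g ∈ φ.dom) ∧ ∀ x ∈ φ.dom, φ.toFun (x * g) = φ.toFun x * g

end CoxPre

namespace CoxeterSystem

variable {B : Type*} {W : Type*} [Group W] {M : CoxeterMatrix B}

section ReflectionRepresentation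

variable (M)

/-- The linear form `v ↦ 2 B(αᵢ, v)` on the geometric representation. -/
noncomputable def rootForm (i : B) : Module.Dual ℝ (B →₀ ℝ) :=
  Finsupp.linearCombination ℝ fun j => -2 * Real.cos (Real.pi / M i j)

theorem rootForm_single (i j : B) :
    rootForm M i (Finsupp.single j 1) = -2 * Real.cos (Real.pi / M i j) := by
  simp [rootForm]

theorem rootForm_self (i : B) : rootForm M i (Finsupp.single i 1) = 2 := by
  simp [rootForm_single]

/-- The reflection of the geometric representation attached to a simple root. -/
noncomputable def rootReflection (i : B) : (B →₀ ℝ) ≃ₗ[ℝ] (B →₀ ℝ) :=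
  Module.reflection (rootForm_self M i)

theorem chebyshev_S_eq_zero {θ : ℝ} (hθ : Real.sin θ ≠ 0) {k : ℤ}
    (h : Real.sin ((k + 1) * θ) = 0) : (Chebyshev.S ℝ k).eval (2 * Real.cos θ) = 0 := by
  have := Chebyshev.S_two_mul_real_cos θ k
  rw [h] at this
  exact (mul_eq_zero.mp this).resolve_right hθ

theorem chebyshev_S_add_eq_zero {θ : ℝ} (hθ : Real.sin θ ≠ 0) {k : ℤ}
    (h : (2 * k + 1) * θ = 2 * Real.pi) :
    (Chebyshev.S ℝ k).eval (2 * Real.cos θ) +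
      (Chebyshev.S ℝ (k - 1)).eval (2 * Real.cos θ) = 0 := by
  have h1 := Chebyshev.S_two_mul_real_cos θ k
  have h2 := Chebyshev.S_two_mul_real_cos θ (k - 1)
  have h3 : Real.sin ((k + 1) * θ) + Real.sin (((k - 1 : ℤ) + 1) * θ) = 0 := by
    have : ((k : ℝ) + 1) * θ = 2 * Real.pi - k * θ := by linarith
    rw [this]
    push_cast
    rw [Real.sin_two_pi_sub]
    simp
  rw [← h1, ← h2, ← add_mul] at h3
  exact (mul_eq_zero.mp h3).resolve_right hθ

theorem rootReflection_isLiftable : M.IsLiftable (rootReflection M) := by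
  intro i j
  obtain rfl | hij := eq_or_ne i j
  · simp only [M.diagonal, pow_one]
    ext1 v
    exact Module.involutive_reflection (rootForm_self M i) v
  have hm1 : M i j ≠ 1 := M.off_diagonal i j hij
  obtain h0 | h0 := eq_or_ne (M i j) 0
  · simp [h0]
  set m := M i j with hm
  set θ : ℝ := 2 * (Real.pi / m) with hθdef
  have hmpos : (0 : ℝ) < m := by positivity
  have hfy : rootForm M i (Finsupp.single j 1) = -2 * Real.cos (Real.pi / m) :=
    rootForm_single M i j
  have hgx : rootForm M j (Finsupp.single i 1) = -2 * Real.cos (Real.pi / m) := by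
    rw [rootForm_single, M.symmetric j i]
  have ht : 2 * Real.cos θ =
      rootForm M i (Finsupp.single j 1) * rootForm M j (Finsupp.single i 1) - 2 := by
    rw [hfy, hgx, hθdef, Real.cos_two_mul]; ring
  ext1 z
  have key := Module.reflection_mul_reflection_pow_apply (rootForm_self M i) (rootForm_self M j)
    m z _ ht
  change ((rootReflection M i * rootReflection M j) ^ m) z = _ at key
  rw [key]
  obtain h2 | h2 := eq_or_ne m 2
  · have hc : Real.cos (Real.pi / m) = 0 := by rw [h2]; simp
    rw [hfy, hgx]
    rw [hc] at hfy hgx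
    have ht' : 2 * Real.cos θ = -2 := by rw [ht, hfy, hgx]; norm_num
    rw [ht', hc, h2]
    norm_num
    module
  have hsin : Real.sin θ ≠ 0 := by
    apply ne_of_gt
    apply Real.sin_pos_of_pos_of_lt_pi
    · positivity
    · have : (3 : ℝ) ≤ m := by exact_mod_cast (by omega : 3 ≤ m)
      rw [hθdef, ← mul_div_assoc, div_lt_iff₀ hmpos]
      nlinarith [Real.pi_pos]
  obtain ⟨k, hk⟩ := Nat.even_or_odd' m
  obtain hk | hk := hk
  · have e1 : ((m : ℤ) - 2) / 2 = (k : ℤ) - 1 := by omega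
    have e2 : ((m : ℤ) - 1) / 2 = (k : ℤ) - 1 := by omega
    have hS : (Chebyshev.S ℝ ((k : ℤ) - 1)).eval (2 * Real.cos θ) = 0 := by
      apply chebyshev_S_eq_zero hsin
      have : (((k : ℤ) - 1 : ℤ) + 1 : ℝ) * θ = Real.pi := by
        have : (m : ℝ) = 2 * k := by exact_mod_cast hk
        push_cast
        rw [hθdef]
        field_simp
        rw [this]
        ring
      rw [this, Real.sin_pi]
    rw [e1, e2, hS]
    simp
  · have e1 : ((m : ℤ) - 2) / 2 = (k : ℤ) - 1 := by omega
    have e2 : ((m : ℤ) - 1) / 2 = (k : ℤ) := by omega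
    have e3 : ((m : ℤ) - 3) / 2 = (k : ℤ) - 1 := by omega
    have e4 : (m : ℤ) / 2 = (k : ℤ) := by omega
    have hS := chebyshev_S_add_eq_zero hsin (k := k) (by
        have : (m : ℝ) = 2 * k + 1 := by exact_mod_cast hk
        push_cast
        rw [hθdef, ← this]
        field_simp)
    rw [e1, e2, e3, e4, hS]
    simp

end ReflectionRepresentation

variable (cs : CoxeterSystem M W)

theorem simple_index_injective : Function.Injective cs.simple := by
  intro i j h
  by_contra hij
  have h1 : rootReflection M i = rootReflection M j := by
    rw [← cs.lift_apply_simple (rootReflection_isLiftable M) i, h, cs.lift_apply_simple]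
  have h2 := congrArg (fun f => f (Finsupp.single i 1) i) h1
  simp only [rootReflection, Module.reflection_apply_self, Module.reflection_apply] at h2
  simp [Ne.symm hij] at h2
  norm_num at h2

section StrongExchange

theorem end_mul_apply {α : Type*} (f g : Function.End α) (x : α) : (f * g) x = f (g x) := rfl

open Classical in
/-- The action of a simple reflection on signed group elements, flipping the sign of the
reflection itself. -/
noncomputable def signedConj (i : B) : Function.End (W × ZMod 2) := fun p =>
  (cs.simple i * p.1 * cs.simple i, p.2 + if p.1 = cs.simple i then 1 else 0)

theorem inv_pow_mul_simple (i j : B) (n : ℕ) :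
    ((cs.simple i * cs.simple j) ^ n)⁻¹ * cs.simple j =
      cs.simple j * (cs.simple i * cs.simple j) ^ n := by
  have h : (cs.simple i * cs.simple j)⁻¹ =
      cs.simple j * (cs.simple i * cs.simple j) * (cs.simple j)⁻¹ := by
    simp [mul_assoc]
  rw [← inv_pow, h, conj_pow, inv_mul_cancel_right]

open Classical in
theorem signedConj_mul_pow_apply (i j : B) (n : ℕ) (t : W) (ε : ZMod 2) :
    ((cs.signedConj i * cs.signedConj j) ^ n) (t, ε) =
      ((cs.simple i * cs.simple j) ^ n * t * ((cs.simple i * cs.simple j) ^ n)⁻¹,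
        ε + ∑ q ∈ Finset.range (2 * n),
          if t = cs.simple j * (cs.simple i * cs.simple j) ^ q then 1 else 0) := by
  induction n with
  | zero => simp; rfl
  | succ n ih =>
    rw [pow_succ', end_mul_apply, ih, end_mul_apply]
    set x := cs.simple i * cs.simple j with hx
    have key : ∀ y : W, x ^ n * t * (x ^ n)⁻¹ = y ↔ t = (x ^ n)⁻¹ * y * x ^ n := by
      intro y
      rw [mul_inv_eq_iff_eq_mul, mul_assoc, eq_inv_mul_iff_mul_eq]
    have e1 : x ^ n * t * (x ^ n)⁻¹ = cs.simple j ↔ t = cs.simple j * x ^ (2 * n) := by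
      rw [key, hx, cs.inv_pow_mul_simple, two_mul, pow_add, mul_assoc]
    have e2 : cs.simple j * (x ^ n * t * (x ^ n)⁻¹) * cs.simple j = cs.simple i ↔
        t = cs.simple j * x ^ (2 * n + 1) := by
      have : cs.simple j * (x ^ n * t * (x ^ n)⁻¹) * cs.simple j = cs.simple i ↔
          x ^ n * t * (x ^ n)⁻¹ = cs.simple j * x := by
        generalize x ^ n * t * (x ^ n)⁻¹ = u
        constructor
        · intro h
          rw [hx, ← h]
          simp [mul_assoc]
        · rintro rfl
          simp [hx, mul_assoc]
      rw [this, key, hx, ← mul_assoc, cs.inv_pow_mul_simple, mul_assoc, mul_assoc, ← pow_succ',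
        ← pow_add]
      congr! 3
      ring
    simp only [signedConj]
    rw [mul_add, mul_one, Finset.sum_range_succ, Finset.sum_range_succ]
    simp only [e1, e2]
    refine Prod.ext ?_ ?_
    · simp only [pow_succ' x, mul_inv_rev]
      rw [hx]
      simp only [mul_inv_rev, inv_simple, mul_assoc]
    · simp only [add_assoc]

theorem signedConj_isLiftable : M.IsLiftable cs.signedConj := by
  classical
  intro i j
  funext ⟨t, ε⟩
  rw [signedConj_mul_pow_apply, simple_mul_simple_pow, two_mul, Finset.sum_range_add]
  simp only [pow_add, simple_mul_simple_pow, one_mul, inv_one, mul_one, CharTwo.add_self_eq_zero,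
    add_zero]
  rfl

/-- The action of a Coxeter group on its signed elements. -/
noncomputable def signedAction : W →* Function.End (W × ZMod 2) :=
  cs.lift ⟨cs.signedConj, cs.signedConj_isLiftable⟩

theorem signedAction_simple (i : B) : cs.signedAction (cs.simple i) = cs.signedConj i :=
  cs.lift_apply_simple cs.signedConj_isLiftable i

open Classical in
theorem signedAction_wordProd (ω : List B) (t : W) (ε : ZMod 2) :
    cs.signedAction (cs.wordProd ω) (t, ε) =
      (cs.wordProd ω * t * (cs.wordProd ω)⁻¹, ε + (cs.rightInvSeq ω).count t) := by
  induction ω with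
  | nil => simp; rfl
  | cons i ω ih =>
    rw [wordProd_cons, map_mul, end_mul_apply, ih, signedAction_simple,
      signedConj, rightInvSeq, List.count_cons]
    have : cs.wordProd ω * t * (cs.wordProd ω)⁻¹ = cs.simple i ↔
        (cs.wordProd ω)⁻¹ * cs.simple i * cs.wordProd ω = t := by
      rw [mul_inv_eq_iff_eq_mul, mul_assoc, inv_mul_eq_iff_eq_mul, eq_comm]
    simp only [this]
    refine Prod.ext ?_ ?_
    · simp [mul_assoc]
    · simp only [beq_iff_eq, Nat.cast_add, Nat.cast_ite, Nat.cast_one, Nat.cast_zero, add_assoc]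

theorem signedAction_add (w t : W) (ε : ZMod 2) :
    cs.signedAction w (t, ε) = (w * t * w⁻¹, ε + (cs.signedAction w (t, 0)).2) := by
  classical
  obtain ⟨ω, rfl⟩ := cs.wordProd_surjective w
  simp [signedAction_wordProd]

theorem signedAction_mul (u w t : W) :
    (cs.signedAction (u * w) (t, 0)).2 =
      (cs.signedAction w (t, 0)).2 + (cs.signedAction u (w * t * w⁻¹, 0)).2 := by
  rw [map_mul, end_mul_apply, cs.signedAction_add w,
    cs.signedAction_add u]

theorem signedAction_reflection {t : W} (ht : cs.IsReflection t) :
    (cs.signedAction t (t, 0)).2 = 1 := by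
  obtain ⟨u, i, rfl⟩ := ht
  have h1 := cs.signedAction_mul u u⁻¹ (u * cs.simple i * u⁻¹)
  rw [mul_inv_cancel, map_one] at h1
  rw [mul_assoc u, signedAction_mul, signedAction_mul]
  simp only [mul_assoc, mul_inv_rev, inv_inv, inv_mul_cancel_left, inv_mul_cancel, mul_one,
    inv_simple, simple_mul_simple_cancel_left] at h1 ⊢
  rw [signedAction_simple]
  simp only [signedConj, if_true, zero_add]
  change (0 : ZMod 2) = _ at h1
  rw [add_right_comm, ← h1, zero_add]

/-- The strong exchange property. -/
theorem mem_rightInvSeq_of_length_lt {ω : List B} {t : W} (ht : cs.IsReflection t)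
    (h : cs.length (cs.wordProd ω * t) < cs.length (cs.wordProd ω)) :
    t ∈ cs.rightInvSeq ω := by
  classical
  by_contra hn
  have h0 : (cs.signedAction (cs.wordProd ω) (t, 0)).2 = 0 := by
    rw [signedAction_wordProd, List.count_eq_zero_of_not_mem hn]
    simp
  have h1 : (cs.signedAction (cs.wordProd ω * t) (t, 0)).2 = 1 := by
    rw [signedAction_mul, cs.signedAction_reflection ht, ht.mul_self, one_mul, ht.inv, h0, add_zero]
  obtain ⟨ω', hω', he⟩ := cs.exists_isReduced (cs.wordProd ω * t)
  rw [he, signedAction_wordProd] at h1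
  have hmem : t ∈ cs.rightInvSeq ω' := by
    by_contra hn'
    rw [List.count_eq_zero_of_not_mem hn'] at h1
    simp at h1
  have h2 := (cs.isRightInversion_of_mem_rightInvSeq hω' hmem).2
  rw [← he, mul_assoc, ht.mul_self, mul_one] at h2
  omega

theorem exists_wordProd_eraseIdx {ω : List B} {t : W} (ht : cs.IsReflection t)
    (h : cs.length (cs.wordProd ω * t) < cs.length (cs.wordProd ω)) :
    ∃ k < ω.length, cs.wordProd ω * t = cs.wordProd (ω.eraseIdx k) := by
  obtain ⟨k, hk, hkt⟩ := List.mem_iff_getElem.mp (cs.mem_rightInvSeq_of_length_lt ht h)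
  rw [length_rightInvSeq] at hk
  refine ⟨k, hk, ?_⟩
  rw [← cs.wordProd_mul_getD_rightInvSeq, List.getD_eq_getElem _ _ (by simpa), hkt]

end StrongExchange

end CoxeterSystem

namespace CoxeterSystem

variable {B : Type*} {W : Type*} [Group W] {M : CoxeterMatrix B} (cs : CoxeterSystem M W)

section Bruhat

theorem length_altW (i j : B) (n : ℕ) : (altW i j n).length = n := by
  induction n generalizing i j with
  | zero => rfl
  | succ n ih => simp [altW, ih]

theorem simple_mul_step (i : B) {u t : W} (ht : cs.IsReflection t)
    (h : cs.length u < cs.length (u * t)) :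
    u * t = cs.simple i * u ∨
      cs.length (cs.simple i * u) < cs.length (cs.simple i * u * t) := by
  by_contra! hcon
  obtain ⟨hne, hle⟩ := hcon
  have hlt := lt_of_le_of_ne hle (ht.length_mul_left_ne (cs.simple i * u))
  have h1 := cs.length_simple_mul u i
  have h2 := cs.length_simple_mul (u * t) i
  rw [mul_assoc] at hlt
  obtain ⟨ω, hω, he⟩ := cs.exists_isReduced (cs.simple i * (u * t))
  have hv : cs.wordProd (i :: ω) = u * t := by
    rw [wordProd_cons, ← he, simple_mul_simple_cancel_left]
  have hvt : cs.wordProd (i :: ω) * t = u := by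
    rw [hv, mul_assoc, ht.mul_self, mul_one]
  obtain ⟨k, hk, hku⟩ := cs.exists_wordProd_eraseIdx (ω := i :: ω) ht (by rw [hvt, hv]; exact h)
  rw [hvt] at hku
  cases k with
  | zero =>
    apply hne
    rw [List.eraseIdx_cons_zero, ← he] at hku
    nth_rw 2 [hku]
    rw [simple_mul_simple_cancel_left]
  | succ k =>
    rw [List.eraseIdx_cons_succ, wordProd_cons] at hku
    have h3 : cs.simple i * u = cs.wordProd (ω.eraseIdx k) := by
      rw [hku, simple_mul_simple_cancel_left]
    have h4 := cs.length_wordProd_le (ω.eraseIdx k)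
    have h5 := List.length_eraseIdx_le ω k
    have h6 := hω.eq
    rw [← he] at h6
    rw [← h3] at h4
    omega

variable {cs}

theorem bruhatLE_refl (u : W) : bruhatLE cs u u := Relation.ReflTransGen.refl

theorem bruhatLE_trans {u v w : W} (h : bruhatLE cs u v) (h' : bruhatLE cs v w) :
    bruhatLE cs u w := Relation.ReflTransGen.trans h h'

theorem bruhatLE_mul_reflection {u t : W} (ht : cs.IsReflection t)
    (h : cs.length u < cs.length (u * t)) : bruhatLE cs u (u * t) :=
  Relation.ReflTransGen.single ⟨t, ht, rfl, h⟩

theorem bruhatLE_length_le {u v : W} (h : bruhatLE cs u v) : cs.length u ≤ cs.length v := by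
  induction h with
  | refl => exact le_rfl
  | tail _ h ih =>
    obtain ⟨t, _, _, h⟩ := h
    omega

theorem bruhatLE_eq_of_length_le {u v : W} (h : bruhatLE cs u v)
    (hl : cs.length v ≤ cs.length u) : u = v := by
  cases h with
  | refl => rfl
  | tail h h' =>
    obtain ⟨t, _, _, h'⟩ := h'
    have := bruhatLE_length_le h
    omega

theorem bruhatLE_simple_mul_self (i : B) {u : W} (h : cs.length u < cs.length (cs.simple i * u)) :
    bruhatLE cs u (cs.simple i * u) := by
  have hr : cs.IsReflection (u⁻¹ * cs.simple i * u) := ⟨u⁻¹, i, by simp⟩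
  have he : u * (u⁻¹ * cs.simple i * u) = cs.simple i * u := by group
  rw [← he] at h ⊢
  exact bruhatLE_mul_reflection hr h

theorem simple_mul_bruhatLE_self (i : B) {u : W} (h : cs.length (cs.simple i * u) < cs.length u) :
    bruhatLE cs (cs.simple i * u) u := by
  have := bruhatLE_simple_mul_self (cs := cs) i (u := cs.simple i * u)
  rw [simple_mul_simple_cancel_left] at this
  exact this h

theorem simple_mul_bruhatLE {i : B} {u v : W} (h : bruhatLE cs u v)
    (hv : cs.length (cs.simple i * v) < cs.length v) : bruhatLE cs (cs.simple i * u) v := by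
  induction h using Relation.ReflTransGen.head_induction_on with
  | refl => exact simple_mul_bruhatLE_self i hv
  | head h' h ih =>
    obtain ⟨t, ht, rfl, hl⟩ := h'
    obtain h1 | h1 := cs.simple_mul_step i ht hl
    · rwa [← h1]
    · have := bruhatLE_mul_reflection ht h1
      rw [mul_assoc] at this
      exact bruhatLE_trans this ih

theorem simple_mul_bruhatLE_simple_mul {i : B} {u v : W} (h : bruhatLE cs u v)
    (hv : cs.length v < cs.length (cs.simple i * v)) :
    bruhatLE cs (cs.simple i * u) (cs.simple i * v) := by
  apply simple_mul_bruhatLE (bruhatLE_trans h (bruhatLE_simple_mul_self i hv))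
  rwa [simple_mul_simple_cancel_left]

theorem bruhatLE_simple_mul {i : B} {u v : W} (h : bruhatLE cs u v)
    (hv : cs.length (cs.simple i * v) < cs.length v)
    (hu : cs.length u < cs.length (cs.simple i * u)) : bruhatLE cs u (cs.simple i * v) := by
  induction h with
  | refl => omega
  | @tail w v h h' ih =>
    obtain ⟨t, ht, rfl, hl⟩ := h'
    obtain h1 | h1 := cs.simple_mul_step i ht hl
    · rwa [h1, simple_mul_simple_cancel_left]
    · have h2 := bruhatLE_mul_reflection ht h1
      rw [mul_assoc] at h2
      refine bruhatLE_trans ?_ h2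
      obtain h3 | h3 := cs.length_simple_mul w i
      · exact bruhatLE_trans h (bruhatLE_simple_mul_self i (by omega))
      · exact ih (by omega)

theorem simple_mul_bruhatLE_simple_mul_of_descent {i : B} {u v : W} (h : bruhatLE cs u v)
    (hv : cs.length (cs.simple i * v) < cs.length v)
    (hu : cs.length (cs.simple i * u) < cs.length u) :
    bruhatLE cs (cs.simple i * u) (cs.simple i * v) := by
  apply bruhatLE_simple_mul (bruhatLE_trans (simple_mul_bruhatLE_self i hu) h) hv
  rwa [simple_mul_simple_cancel_left]

theorem bruhatLE_inv {u v : W} (h : bruhatLE cs u v) : bruhatLE cs u⁻¹ v⁻¹ := by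
  induction h with
  | refl => exact bruhatLE_refl _
  | @tail w v _ h' ih =>
    obtain ⟨t, ht, rfl, hl⟩ := h'
    refine bruhatLE_trans ih ?_
    have he : (w * t)⁻¹ = w⁻¹ * (w * t * w⁻¹) := by
      rw [mul_inv_rev, ht.inv]; group
    rw [he]
    apply bruhatLE_mul_reflection (ht.conj w)
    rw [← he, length_inv, length_inv]
    exact hl

theorem mul_simple_bruhatLE {i : B} {u v : W} (h : bruhatLE cs u v)
    (hv : cs.length (v * cs.simple i) < cs.length v) : bruhatLE cs (u * cs.simple i) v := by
  have := simple_mul_bruhatLE (i := i) (bruhatLE_inv h) (by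
    rw [← cs.length_inv, mul_inv_rev, inv_simple, inv_inv, length_inv]
    exact hv)
  have := bruhatLE_inv this
  rwa [mul_inv_rev, inv_simple, inv_inv, inv_inv] at this

theorem mul_simple_bruhatLE_self (i : B) {u : W} (h : cs.length (u * cs.simple i) < cs.length u) :
    bruhatLE cs (u * cs.simple i) u := mul_simple_bruhatLE (bruhatLE_refl u) h

theorem one_bruhatLE (v : W) : bruhatLE cs 1 v := by
  induction hn : cs.length v using Nat.strong_induction_on generalizing v with
  | _ n ih =>
    by_cases hv : v = 1
    · rw [hv]; exact bruhatLE_refl 1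
    obtain ⟨i, hi⟩ := cs.exists_leftDescent_of_ne_one hv
    exact bruhatLE_trans (ih _ (hn ▸ hi) _ rfl) (simple_mul_bruhatLE_self i hi)

theorem exists_coatom_bruhatLE {u v : W} (h : bruhatLE cs u v) (hne : u ≠ v) :
    ∃ z, bruhatLE cs u z ∧ bruhatLE cs z v ∧ cs.length v = cs.length z + 1 := by
  induction hn : cs.length v using Nat.strong_induction_on generalizing u v with
  | _ n ih =>
    have hv : v ≠ 1 := by
      rintro rfl
      exact hne (bruhatLE_eq_of_length_le h (by simp))
    obtain ⟨i, hi⟩ := cs.exists_leftDescent_of_ne_one hv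
    have hi' := cs.isLeftDescent_iff.mp hi
    have hiv := simple_mul_bruhatLE_self i hi
    obtain hu | hu := cs.length_simple_mul u i
    · exact ⟨_, bruhatLE_simple_mul h hi (by omega), hiv, by omega⟩
    · have hsu := simple_mul_bruhatLE_simple_mul_of_descent h hi (by omega)
      obtain ⟨z, h1, h2, h3⟩ := ih _ (hn ▸ hi) hsu (by simpa using hne) rfl
      obtain hz | hz := cs.length_simple_mul z i
      · refine ⟨cs.simple i * z, ?_, simple_mul_bruhatLE (bruhatLE_trans h2 hiv) hi, by omega⟩
        have := simple_mul_bruhatLE_simple_mul (i := i) h1 (by omega)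
        rwa [simple_mul_simple_cancel_left] at this
      · refine ⟨_, ?_, hiv, by omega⟩
        have := simple_mul_bruhatLE (i := i) h1 (by omega)
        rw [simple_mul_simple_cancel_left] at this
        exact bruhatLE_trans this h2

theorem bCov_iff {u v : W} :
    bCov cs u v ↔ bruhatLE cs u v ∧ cs.length v = cs.length u + 1 := by
  constructor
  · rintro ⟨h, hne, hz⟩
    obtain ⟨z, h1, h2, h3⟩ := exists_coatom_bruhatLE h hne
    obtain rfl | rfl := hz z h1 h2
    · exact ⟨h, h3⟩
    · omega
  · rintro ⟨h, hl⟩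
    refine ⟨h, by rintro rfl; omega, fun z h1 h2 => ?_⟩
    have h3 := bruhatLE_length_le h1
    by_cases h4 : cs.length z ≤ cs.length u
    · exact Or.inl (bruhatLE_eq_of_length_le h1 h4).symm
    · exact Or.inr (bruhatLE_eq_of_length_le h2 (by omega))

theorem bCov.length_eq {u v : W} (h : bCov cs u v) : cs.length v = cs.length u + 1 :=
  (bCov_iff.mp h).2

theorem bCov.le {u v : W} (h : bCov cs u v) : bruhatLE cs u v := h.1

theorem bruhatLE_iff_eq_or_coatom {u v : W} :
    bruhatLE cs u v ↔ u = v ∨ ∃ z, bCov cs z v ∧ bruhatLE cs u z := by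
  constructor
  · intro h
    by_cases hne : u = v
    · exact Or.inl hne
    · obtain ⟨z, h1, h2, h3⟩ := exists_coatom_bruhatLE h hne
      exact Or.inr ⟨z, bCov_iff.mpr ⟨h2, h3⟩, h1⟩
  · rintro (rfl | ⟨z, h1, h2⟩)
    · exact bruhatLE_refl _
    · exact bruhatLE_trans h2 h1.le

theorem bCov_simple_mul {i : B} {u : W} (h : cs.length u < cs.length (cs.simple i * u)) :
    bCov cs u (cs.simple i * u) := by
  have := cs.length_simple_mul u i
  exact bCov_iff.mpr ⟨bruhatLE_simple_mul_self i h, by omega⟩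

theorem simple_mul_bCov {i : B} {u : W} (h : cs.length (cs.simple i * u) < cs.length u) :
    bCov cs (cs.simple i * u) u := by
  have := cs.length_simple_mul u i
  exact bCov_iff.mpr ⟨simple_mul_bruhatLE_self i h, by omega⟩

theorem mul_simple_bCov {i : B} {u : W} (h : cs.length (u * cs.simple i) < cs.length u) :
    bCov cs (u * cs.simple i) u := by
  have := cs.length_mul_simple u i
  exact bCov_iff.mpr ⟨mul_simple_bruhatLE_self i h, by omega⟩

/-- Left multiplication by a simple reflection satisfies the coatom condition. -/
theorem bCov_simple_mul_iff {i : B} {v c : W} (h : cs.length v < cs.length (cs.simple i * v)) :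
    bCov cs c (cs.simple i * v) ↔
      c = v ∨ ∃ u, bCov cs u v ∧ cs.length u < cs.length (cs.simple i * u) ∧
        c = cs.simple i * u := by
  have hl := cs.length_simple_mul v i
  have hd : cs.length (cs.simple i * (cs.simple i * v)) < cs.length (cs.simple i * v) := by
    rwa [simple_mul_simple_cancel_left]
  constructor
  · intro hc
    have h1 := hc.length_eq
    obtain hci | hci := cs.length_simple_mul c i
    · left
      have := bruhatLE_simple_mul hc.le hd (by omega)
      rw [simple_mul_simple_cancel_left] at this
      exact bruhatLE_eq_of_length_le this (by omega)
    · right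
      have := simple_mul_bruhatLE_simple_mul_of_descent hc.le hd (by omega)
      rw [simple_mul_simple_cancel_left] at this
      refine ⟨cs.simple i * c, bCov_iff.mpr ⟨this, by omega⟩, ?_, by simp⟩
      rw [simple_mul_simple_cancel_left]
      omega
  · rintro (rfl | ⟨u, hu, hui, rfl⟩)
    · exact bCov_simple_mul h
    · have h1 := hu.length_eq
      have h2 := cs.length_simple_mul u i
      exact bCov_iff.mpr ⟨simple_mul_bruhatLE_simple_mul hu.le h, by omega⟩

theorem simple_mul_eq_mul_simple_of_coatoms {y y' : W}
    (hcoat : ∀ c, bCov cs c y ↔ bCov cs c y') (hne : y ≠ y')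
    (hl : cs.length y = cs.length y') {l r : B}
    (hy : cs.length (cs.simple l * y) < cs.length y)
    (hy' : cs.length (y' * cs.simple r) < cs.length y') :
    cs.simple l * y = y' * cs.simple r := by
  have hr : cs.length y < cs.length (y * cs.simple r) := by
    by_contra hcon
    have h1 : cs.length (y * cs.simple r) < cs.length y :=
      lt_of_le_of_ne (by omega) (cs.length_mul_simple_ne y r)
    have h2 := mul_simple_bruhatLE ((hcoat _).mpr (mul_simple_bCov hy')).le h1
    rw [simple_mul_simple_cancel_right] at h2
    exact hne (bruhatLE_eq_of_length_le h2 (by omega)).symm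
  have hc := (hcoat _).mp (simple_mul_bCov hy)
  have h0 := hc.length_eq
  obtain h1 | h1 := cs.length_mul_simple (cs.simple l * y) r
  · have h2 := mul_simple_bruhatLE hc.le hy'
    have h3 := bruhatLE_eq_of_length_le h2 (by omega)
    rw [← h3, simple_mul_simple_cancel_right]
  · have h2 := cs.length_simple_mul (y * cs.simple r) l
    rw [← mul_assoc] at h2
    omega

/-- Distinct elements of the same length with the same coatoms lie in a common dihedral
parabolic subgroup. -/
theorem exists_altW_of_coatoms {y y' : W}
    (hcoat : ∀ c, bCov cs c y ↔ bCov cs c y') (hne : y ≠ y')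
    (hl : cs.length y = cs.length y') :
    ∃ l l', y = cs.wordProd (altW l l' (cs.length y)) := by
  have hy : y ≠ 1 := by
    rintro rfl
    rw [length_one] at hl
    exact hne (cs.length_eq_zero_iff.mp hl.symm).symm
  have hy' : y' ≠ 1 := by
    rintro rfl
    rw [length_one] at hl
    exact hne (cs.length_eq_zero_iff.mp hl)
  obtain ⟨l, hl1⟩ := cs.exists_leftDescent_of_ne_one hy
  obtain ⟨l', hl2⟩ := cs.exists_leftDescent_of_ne_one hy'
  refine ⟨l, l', ?_⟩
  have step : ∀ (y y' : W) (l l' : B), (∀ c, bCov cs c y ↔ bCov cs c y') → y ≠ y' →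
      cs.length y = cs.length y' → cs.length (cs.simple l' * y') < cs.length y' →
      ∀ k < cs.length y, (∃ z, cs.length z + k = cs.length y ∧ y = cs.wordProd (altW l l' k) * z) →
      ∃ z, cs.length z + (k + 1) = cs.length y' ∧ y' = cs.wordProd (altW l' l (k + 1)) * z := by
    intro y y' l l' hcoat hne hl hl' k hk ⟨z, hz, hyz⟩
    have hz1 : z ≠ 1 := by
      rintro rfl
      rw [length_one] at hz
      omega
    obtain ⟨q, hq⟩ := cs.exists_rightDescent_of_ne_one hz1
    have hq' := cs.isRightDescent_iff.mp hq
    have hyq : cs.length (y * cs.simple q) < cs.length y := by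
      have h1 := cs.length_mul_le (cs.wordProd (altW l l' k)) (z * cs.simple q)
      have h2 := cs.length_wordProd_le (altW l l' k)
      rw [length_altW] at h2
      rw [← mul_assoc, ← hyz] at h1
      omega
    have h4 := simple_mul_eq_mul_simple_of_coatoms (fun c => (hcoat c).symm) hne.symm hl.symm
      hl' hyq
    refine ⟨z * cs.simple q, by omega, ?_⟩
    rw [altW, wordProd_cons, mul_assoc, ← mul_assoc (cs.wordProd _), ← hyz, ← h4,
      simple_mul_simple_cancel_left]
  have main : ∀ k ≤ cs.length y,
      (∃ z, cs.length z + k = cs.length y ∧ y = cs.wordProd (altW l l' k) * z) ∧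
      (∃ z, cs.length z + k = cs.length y' ∧ y' = cs.wordProd (altW l' l k) * z) := by
    intro k hk
    induction k with
    | zero => exact ⟨⟨y, by simp, by simp [altW]⟩, ⟨y', by simp, by simp [altW]⟩⟩
    | succ k ih =>
      obtain ⟨h1, h2⟩ := ih (by omega)
      exact ⟨step y' y l' l (fun c => (hcoat c).symm) hne.symm hl.symm hl1 k (by omega) h2,
        step y y' l l' hcoat hne hl hl2 k (by omega) h1⟩
  obtain ⟨⟨z, hz, hyz⟩, -⟩ := main _ le_rfl
  have : z = 1 := cs.length_eq_zero_iff.mp (by omega)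
  rw [this, mul_one] at hyz
  exact hyz

end Bruhat

section Dihedral

theorem mem_altW {i j k : B} {n : ℕ} (h : k ∈ altW i j n) : k = i ∨ k = j := by
  induction n generalizing i j with
  | zero => simp [altW] at h
  | succ n ih =>
    rw [altW, List.mem_cons] at h
    obtain rfl | h := h
    · exact Or.inl rfl
    · exact (ih h).symm

/-- The last letter of the alternating word can be split off. -/
theorem altW_succ_eq_concat (i j : B) (n : ℕ) :
    ∃ k, altW i j (n + 1) = (altW i j n).concat k := by
  induction n generalizing i j with
  | zero => exact ⟨i, rfl⟩
  | succ n ih =>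
    obtain ⟨k, h⟩ := ih j i
    exact ⟨k, by rw [altW, h]; rfl⟩

variable {cs}

theorem simple_left_mem_dihedral (s a : B) : cs.simple s ∈ dihedral cs s a :=
  Subgroup.subset_closure (by simp)

theorem simple_right_mem_dihedral (s a : B) : cs.simple a ∈ dihedral cs s a :=
  Subgroup.subset_closure (by simp)

theorem one_mem_dihedral (s a : B) : (1 : W) ∈ dihedral cs s a :=
  one_mem (Subgroup.closure _)

theorem mul_mem_dihedral {s a : B} {u v : W} (hu : u ∈ dihedral cs s a)
    (hv : v ∈ dihedral cs s a) : u * v ∈ dihedral cs s a :=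
  mul_mem (S := Subgroup W) hu hv

theorem wordProd_mem_dihedral {s a : B} {ω : List B} (h : ∀ k ∈ ω, k = s ∨ k = a) :
    cs.wordProd ω ∈ dihedral cs s a := by
  induction ω with
  | nil => simpa using one_mem_dihedral s a
  | cons i ω ih =>
    rw [wordProd_cons]
    refine mul_mem_dihedral ?_ (ih fun k hk => h k (List.mem_cons_of_mem _ hk))
    obtain rfl | rfl := h i List.mem_cons_self
    · exact simple_left_mem_dihedral _ _
    · exact simple_right_mem_dihedral _ _

theorem exists_wordProd_of_mem_dihedral {s a : B} {v : W} (h : v ∈ dihedral cs s a) :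
    ∃ ω : List B, (∀ k ∈ ω, k = s ∨ k = a) ∧ v = cs.wordProd ω := by
  change v ∈ Subgroup.closure _ at h
  induction h using Subgroup.closure_induction with
  | mem x hx =>
    obtain rfl | rfl := hx
    · exact ⟨[s], by simp, by simp⟩
    · exact ⟨[a], by simp, by simp⟩
  | one => exact ⟨[], by simp, by simp⟩
  | mul x y _ _ hx hy =>
    obtain ⟨ω, h1, rfl⟩ := hx
    obtain ⟨ω', h2, rfl⟩ := hy
    refine ⟨ω ++ ω', fun k hk => ?_, by rw [wordProd_append]⟩
    exact (List.mem_append.mp hk).elim (h1 k) (h2 k)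
  | inv x _ hx =>
    obtain ⟨ω, h1, rfl⟩ := hx
    exact ⟨ω.reverse, fun k hk => h1 k (List.mem_reverse.mp hk), by rw [wordProd_reverse]⟩

theorem mem_dihedral_of_bruhatLE {s a : B} {u v : W} (h : bruhatLE cs u v)
    (hv : v ∈ dihedral cs s a) : u ∈ dihedral cs s a := by
  induction h using Relation.ReflTransGen.head_induction_on with
  | refl => exact hv
  | @head u w h' h ih =>
    obtain ⟨t, ht, rfl, hl⟩ := h'
    obtain ⟨ω, hω, he⟩ := exists_wordProd_of_mem_dihedral ih
    have hu : cs.wordProd ω * t = u := by rw [← he, mul_assoc, ht.mul_self, mul_one]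
    obtain ⟨k, _, hk⟩ := cs.exists_wordProd_eraseIdx (ω := ω) ht (by rwa [hu, ← he])
    rw [← hu, hk]
    exact wordProd_mem_dihedral fun i hi => hω i (List.mem_of_mem_eraseIdx hi)

theorem exists_isReduced_of_mem_dihedral {s a : B} {v : W} (h : v ∈ dihedral cs s a) :
    ∃ ω : List B, (∀ k ∈ ω, k = s ∨ k = a) ∧ cs.IsReduced ω ∧ v = cs.wordProd ω := by
  obtain ⟨ω, hω, rfl⟩ := exists_wordProd_of_mem_dihedral h
  clear h
  induction ω with
  | nil => exact ⟨[], by simp, by simp [IsReduced], rfl⟩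
  | cons i ω ih =>
    obtain ⟨ω', h1, h2, h3⟩ := ih fun k hk => hω k (List.mem_cons_of_mem _ hk)
    rw [wordProd_cons, h3]
    have h4 := h2.eq
    obtain h5 | h5 := cs.length_simple_mul (cs.wordProd ω') i
    · refine ⟨i :: ω', ?_, ?_, by rw [wordProd_cons]⟩
      · intro k hk
        obtain rfl | hk := List.mem_cons.mp hk
        · exact hω _ List.mem_cons_self
        · exact h1 k hk
      · rw [IsReduced, wordProd_cons, List.length_cons]
        omega
    · have ht : cs.IsReflection ((cs.wordProd ω')⁻¹ * cs.simple i * cs.wordProd ω') :=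
        ⟨(cs.wordProd ω')⁻¹, i, by simp⟩
      have he : cs.wordProd ω' * ((cs.wordProd ω')⁻¹ * cs.simple i * cs.wordProd ω') =
          cs.simple i * cs.wordProd ω' := by group
      obtain ⟨k, hk, hkw⟩ := cs.exists_wordProd_eraseIdx (ω := ω') ht (by rw [he]; omega)
      rw [he] at hkw
      refine ⟨ω'.eraseIdx k, fun j hj => h1 j (List.mem_of_mem_eraseIdx hj), ?_, hkw⟩
      rw [IsReduced, ← hkw, List.length_eraseIdx_of_lt hk]
      omega

theorem eq_altW_of_isReduced {s a : B} {ω : List B} (h : ∀ k ∈ ω, k = s ∨ k = a)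
    (hω : cs.IsReduced ω) : ω = altW s a ω.length ∨ ω = altW a s ω.length := by
  induction ω with
  | nil => exact Or.inl rfl
  | cons i ω ih =>
    have hω' : cs.IsReduced ω := by
      simpa using hω.drop 1
    have hhead : ∀ ω', ω ≠ i :: ω' := by
      rintro ω' rfl
      have h1 := hω.eq
      rw [wordProd_cons, wordProd_cons, simple_mul_simple_cancel_left] at h1
      have h2 := cs.length_wordProd_le ω'
      simp only [List.length_cons] at h1
      omega
    have hi := h i List.mem_cons_self
    have ih := ih (fun k hk => h k (List.mem_cons_of_mem _ hk)) hω'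
    rw [List.length_cons]
    cases hn : ω.length with
    | zero =>
      rw [List.length_eq_zero_iff] at hn
      subst hn
      obtain rfl | rfl := hi
      · exact Or.inl rfl
      · exact Or.inr rfl
    | succ n =>
      rw [hn] at ih
      obtain ih | ih := ih <;> obtain rfl | rfl := hi
      · exact absurd ih (hhead _)
      · right
        rw [altW, ← ih]
      · left
        rw [altW, ← ih]
      · exact absurd ih (hhead _)

theorem eq_wordProd_altW_of_mem_dihedral {s a : B} {v : W} (h : v ∈ dihedral cs s a) :
    v = cs.wordProd (altW s a (cs.length v)) ∨ v = cs.wordProd (altW a s (cs.length v)) := by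
  obtain ⟨ω, h1, h2, rfl⟩ := exists_isReduced_of_mem_dihedral h
  rw [h2.eq]
  obtain h3 | h3 := eq_altW_of_isReduced h1 h2
  · exact Or.inl (congrArg _ h3)
  · exact Or.inr (congrArg _ h3)

theorem eq_or_eq_of_simple_mem_dihedral {s a k : B} (h : cs.simple k ∈ dihedral cs s a) :
    k = s ∨ k = a := by
  have h1 := eq_wordProd_altW_of_mem_dihedral h
  rw [length_simple] at h1
  simpa [altW, cs.simple_index_injective.eq_iff] using h1

theorem wordProd_altW_bruhatLE {i j : B} {n : ℕ}
    (h : cs.length (cs.wordProd (altW i j (n + 1))) = n + 1) :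
    bruhatLE cs (cs.wordProd (altW i j n)) (cs.wordProd (altW i j (n + 1))) ∧
      bruhatLE cs (cs.wordProd (altW j i n)) (cs.wordProd (altW i j (n + 1))) := by
  constructor
  · obtain ⟨k, hk⟩ := altW_succ_eq_concat i j n
    have h1 := cs.length_wordProd_le (altW i j n)
    rw [length_altW] at h1
    rw [hk, wordProd_concat] at h ⊢
    have := mul_simple_bruhatLE_self (cs := cs) k
      (u := cs.wordProd (altW i j n) * cs.simple k)
    rw [simple_mul_simple_cancel_right] at this
    exact this (by omega)
  · have h1 := cs.length_wordProd_le (altW j i n)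
    rw [length_altW] at h1
    rw [altW, wordProd_cons] at h ⊢
    exact bruhatLE_simple_mul_self i (by omega)

/-- In a dihedral parabolic subgroup, the Bruhat order is the order by length. -/
theorem bruhatLE_of_mem_dihedral {s a : B} {u v : W} (hu : u ∈ dihedral cs s a)
    (hv : v ∈ dihedral cs s a) (h : cs.length u < cs.length v) : bruhatLE cs u v := by
  induction hn : cs.length v generalizing v with
  | zero => omega
  | succ n ih =>
    obtain ⟨i, j, hij, hvw⟩ : ∃ i j, (i = s ∧ j = a ∨ i = a ∧ j = s) ∧
        v = cs.wordProd (altW i j (n + 1)) := by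
      obtain h1 | h1 := eq_wordProd_altW_of_mem_dihedral hv
      · exact ⟨s, a, Or.inl ⟨rfl, rfl⟩, hn ▸ h1⟩
      · exact ⟨a, s, Or.inr ⟨rfl, rfl⟩, hn ▸ h1⟩
    rw [hvw] at hn
    obtain ⟨h1, h2⟩ := wordProd_altW_bruhatLE hn
    rw [← hvw] at h1 h2 hn
    by_cases hun : cs.length u = n
    · have h3 := eq_wordProd_altW_of_mem_dihedral hu
      rw [hun] at h3
      obtain ⟨rfl, rfl⟩ | ⟨rfl, rfl⟩ := hij <;> obtain h3 | h3 := h3 <;> rw [h3] <;> assumption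
    · obtain ⟨z, -, hz, hvz⟩ := exists_coatom_bruhatLE (cs := cs) (one_bruhatLE v) (by
        rintro rfl
        simp at hn)
      exact bruhatLE_trans (ih (mem_dihedral_of_bruhatLE hz hv) (by omega) (by omega)) hz

/-- An element of length at least two lies in a dihedral parabolic subgroup as soon as its
coatoms do. -/
theorem mem_dihedral_of_coatoms {s a : B} {w : W} (hw : 2 ≤ cs.length w)
    (h : ∀ c, bCov cs c w → c ∈ dihedral cs s a) : w ∈ dihedral cs s a := by
  obtain ⟨q, hq⟩ := cs.exists_leftDescent_of_ne_one (w := w) (by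
    rintro rfl
    simp at hw)
  have hq' := cs.isLeftDescent_iff.mp hq
  obtain ⟨r, hr⟩ := cs.exists_rightDescent_of_ne_one (w := cs.simple q * w) (by
    intro h1
    rw [h1, length_one] at hq'
    omega)
  have hr' := cs.isRightDescent_iff.mp hr
  have hrw : cs.length (w * cs.simple r) < cs.length w := by
    have := cs.length_simple_mul (w * cs.simple r) q
    rw [← mul_assoc] at this
    omega
  have h1 : cs.simple r ∈ dihedral cs s a := by
    refine mem_dihedral_of_bruhatLE ?_ (h _ (simple_mul_bCov hq))
    simpa using mul_simple_bruhatLE (one_bruhatLE _) hr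
  simpa using mul_mem_dihedral (h _ (mul_simple_bCov hrw)) h1

end Dihedral

end CoxeterSystem

namespace BSM

variable {B : Type*} {W : Type*} [Group W] {M : CoxeterMatrix B} {cs : CoxeterSystem M W}
  {φ : BSM cs}

theorem length_toFun {x : W} (hx : x ∈ φ.dom) :
    cs.length (φ.toFun x) = cs.length x + 1 ∨ cs.length (φ.toFun x) + 1 = cs.length x :=
  (φ.cov x hx).symm.imp (fun h => h.length_eq) fun h => h.length_eq.symm

theorem bCov_toFun {x : W} (hx : x ∈ φ.dom) (h : cs.length x < cs.length (φ.toFun x)) :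
    bCov cs x (φ.toFun x) :=
  (φ.cov x hx).resolve_left fun h' => by have := h'.length_eq; omega

theorem toFun_bCov {x : W} (hx : x ∈ φ.dom) (h : cs.length (φ.toFun x) < cs.length x) :
    bCov cs (φ.toFun x) x :=
  (φ.cov x hx).resolve_right fun h' => by have := h'.length_eq; omega

theorem bCov_toFun_iff {u c : W} (hu : u ∈ φ.dom) (h : bCov cs u (φ.toFun u)) :
    bCov cs c (φ.toFun u) ↔
      c = u ∨ ∃ v, bCov cs v u ∧ bCov cs v (φ.toFun v) ∧ c = φ.toFun v :=
  Set.ext_iff.mp (φ.coatom u hu h) c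

theorem mem_of_bCov {u v : W} (hv : v ∈ φ.dom) (h : bCov cs u v) : u ∈ φ.dom :=
  φ.ideal hv h.le

open Classical in
/-- Extension of a partial special matching by one matched pair. -/
noncomputable def insertPair (φ : BSM cs) {p q : W} (hpq : bCov cs p q) (hp : p ∉ φ.dom)
    (hq : q ∉ φ.dom) (hcp : ∀ c, bCov cs c p → c ∈ φ.dom)
    (hcq : ∀ c, bCov cs c q → c = p ∨ c ∈ φ.dom)
    (hcoat : ∀ c, bCov cs c q ↔
      c = p ∨ ∃ v, bCov cs v p ∧ bCov cs v (φ.toFun v) ∧ c = φ.toFun v) : BSM cs :=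
  have hne : q ≠ p := hpq.2.1.symm
  have hout : ∀ x ∈ φ.dom, x ≠ p ∧ x ≠ q := fun x hx =>
    ⟨fun h => hp (h ▸ hx), fun h => hq (h ▸ hx)⟩
  { dom := {x | x = p ∨ x = q ∨ x ∈ φ.dom}
    toFun := fun x => if x = p then q else if x = q then p else φ.toFun x
    ideal := by
      have hip : ∀ x, bruhatLE cs x p → x = p ∨ x ∈ φ.dom := by
        intro x hx
        obtain h | ⟨z, hz, hxz⟩ := bruhatLE_iff_eq_or_coatom.mp hx
        · exact Or.inl h
        · exact Or.inr (φ.ideal (hcp z hz) hxz)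
      rintro x y (rfl | rfl | hy) hxy
      · exact (hip x hxy).imp_right Or.inr
      · obtain h | ⟨z, hz, hxz⟩ := bruhatLE_iff_eq_or_coatom.mp hxy
        · exact Or.inr (Or.inl h)
        · obtain rfl | hz := hcq z hz
          · exact (hip x hxz).imp_right Or.inr
          · exact Or.inr (Or.inr (φ.ideal hz hxz))
      · exact Or.inr (Or.inr (φ.ideal hy hxy))
    maps := by
      rintro x (rfl | rfl | hx)
      · simp
      · simp [hne]
      · obtain ⟨h1, h2⟩ := hout x hx
        rw [if_neg h1, if_neg h2]
        exact Or.inr (Or.inr (φ.maps x hx))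
    invol := by
      rintro x (rfl | rfl | hx)
      · simp [hne]
      · simp [hne]
      · obtain ⟨h1, h2⟩ := hout x hx
        obtain ⟨h3, h4⟩ := hout _ (φ.maps x hx)
        rw [if_neg h1, if_neg h2, if_neg h3, if_neg h4]
        exact φ.invol x hx
    cov := by
      rintro x (rfl | rfl | hx)
      · right
        simpa using hpq
      · left
        simpa [hne] using hpq
      · obtain ⟨h1, h2⟩ := hout x hx
        rw [if_neg h1, if_neg h2]
        exact φ.cov x hx
    coatom := by
      have key : ∀ u, (∀ c, bCov cs c u → c ∈ φ.dom) →
          {w | ∃ v, bCov cs v u ∧ bCov cs v (if v = p then q else if v = q then p else φ.toFun v) ∧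
            w = if v = p then q else if v = q then p else φ.toFun v} =
          {w | ∃ v, bCov cs v u ∧ bCov cs v (φ.toFun v) ∧ w = φ.toFun v} := by
        intro u hu
        ext w
        refine exists_congr fun v => and_congr_right fun hv => ?_
        obtain ⟨h1, h2⟩ := hout v (hu v hv)
        rw [if_neg h1, if_neg h2]
      rintro x (rfl | rfl | hx) hcov
      · rw [key _ hcp, if_pos rfl]
        exact Set.ext hcoat
      · rw [if_neg hne, if_pos rfl] at hcov
        have h1 := hpq.length_eq
        have h2 := hcov.length_eq
        omega
      · obtain ⟨h1, h2⟩ := hout x hx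
        rw [if_neg h1, if_neg h2] at hcov ⊢
        rw [key x fun c hc => mem_of_bCov hx hc]
        exact φ.coatom x hx hcov }

end BSM

section Maximal

variable {B : Type*} {W : Type*} [Group W] {M : CoxeterMatrix B} {cs : CoxeterSystem M W}
  {φ : BSM cs}

theorem BMax.mem_of_insertPair (hmax : BMax φ) {p q : W} (hpq : bCov cs p q)
    (hcp : ∀ c, bCov cs c p → c ∈ φ.dom) (hcq : ∀ c, bCov cs c q → c = p ∨ c ∈ φ.dom)
    (hcoat : ∀ c, bCov cs c q ↔
      c = p ∨ ∃ v, bCov cs v p ∧ bCov cs v (φ.toFun v) ∧ c = φ.toFun v)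
    (hq : q ∉ φ.dom) : p ∈ φ.dom := by
  by_contra hp
  have h := hmax (φ.insertPair hpq hp hq hcp hcq hcoat)
    ⟨fun x hx => Or.inr (Or.inr hx), fun x hx => by
      have h1 : x ≠ p := fun h => hp (h ▸ hx)
      have h2 : x ≠ q := fun h => hq (h ▸ hx)
      simp [BSM.insertPair, h1, h2]⟩
  exact hp (h ▸ Or.inl rfl)

end Maximal

section Regular

variable {B : Type*} {W : Type*} [Group W] {M : CoxeterMatrix B} {cs : CoxeterSystem M W}
  {φ : BSM cs} {s a : B}

theorem BSM.toFun_mem_dihedral (ha : φ.toFun 1 = cs.simple a) {x : W} (hx : x ∈ φ.dom)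
    (hxP : x ∈ dihedral cs s a) : φ.toFun x ∈ dihedral cs s a := by
  induction hn : cs.length x using Nat.strong_induction_on generalizing x with
  | _ n ih =>
    obtain hl | hl := φ.length_toFun hx
    · by_cases hx1 : x = 1
      · rw [hx1, ha]
        exact simple_right_mem_dihedral s a
      have hx2 : cs.length x ≠ 0 := fun h => hx1 (cs.length_eq_zero_iff.mp h)
      refine mem_dihedral_of_coatoms (by omega) fun c hc => ?_
      obtain rfl | ⟨v, hv, -, rfl⟩ := (φ.bCov_toFun_iff hx (φ.bCov_toFun hx (by omega))).mp hc
      · exact hxP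
      · have := hv.length_eq
        exact ih _ (by omega) (φ.mem_of_bCov hx hv) (mem_dihedral_of_bruhatLE hv.le hxP) rfl
    · exact mem_dihedral_of_bruhatLE (φ.toFun_bCov hx (by omega)).le hxP

/-- The domain of a maximal regular partial special matching contains the principal dihedral
subgroup. -/
theorem mem_dom_of_mem_dihedral (hmax : BMax φ) (h1 : (1 : W) ∈ φ.dom)
    (ha : φ.toFun 1 = cs.simple a) (hreg : LeftReg φ (cs.simple s)) {x : W}
    (hxP : x ∈ dihedral cs s a) : x ∈ φ.dom := by
  have hs : ∀ y, cs.simple s * y ∈ φ.dom → y ∈ φ.dom := fun y hy => by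
    simpa using hreg.1 _ hy
  have hsP : ∀ y ∈ dihedral cs s a, cs.simple s * y ∈ dihedral cs s a := fun y hy =>
    mul_mem_dihedral (simple_left_mem_dihedral s a) hy
  induction hn : cs.length x using Nat.strong_induction_on generalizing x with
  | _ n ih =>
    by_contra hxQ
    have hsx : cs.length x < cs.length (cs.simple s * x) := by
      obtain h | h := cs.length_simple_mul x s
      · omega
      · exact absurd (hs x (ih _ (by omega) (hsP x hxP) rfl)) hxQ
    have hsx' := cs.length_simple_mul x s
    have hsxQ : cs.simple s * x ∉ φ.dom := fun h => hxQ (hs x h)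
    obtain ⟨k, hk⟩ : ∃ k, cs.length x = k + 1 := by
      refine Nat.exists_eq_succ_of_ne_zero fun h => hxQ ?_
      rwa [cs.length_eq_zero_iff.mp h]
    have hcx : ∀ c, bCov cs c x → c ∈ φ.dom ∧ c ∈ dihedral cs s a := by
      intro c hc
      have hcP := mem_dihedral_of_bruhatLE hc.le hxP
      have := hc.length_eq
      exact ⟨ih _ (by omega) hcP rfl, hcP⟩
    -- the dihedral subgroup has at most two elements of each length
    have huniq : ∀ w ∈ dihedral cs s a, cs.length w = k + 1 → w ≠ x →
        w = cs.wordProd (altW s a (k + 1)) := by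
      intro w hw hwl hwx
      have hx := eq_wordProd_altW_of_mem_dihedral hxP
      rw [hk] at hx
      replace hx := hx.resolve_left fun h => by
        have := cs.length_wordProd_le (altW a s k)
        rw [length_altW] at this
        rw [h, altW, wordProd_cons, simple_mul_simple_cancel_left] at hsx
        rw [h, altW, wordProd_cons] at hk
        omega
      have hw' := eq_wordProd_altW_of_mem_dihedral hw
      rw [hwl] at hw'
      exact hw'.resolve_right fun h => hwx (h.trans hx.symm)
    have hdown : ∀ w ∈ φ.dom, w ∈ dihedral cs s a → cs.length w ≤ k + 1 := by
      intro w hw hwP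
      by_contra hcon
      exact hxQ (φ.ideal hw (bruhatLE_of_mem_dihedral hxP hwP (by omega)))
    obtain ⟨u, hu, hus⟩ : ∃ u, bCov cs u x ∧ cs.length u < cs.length (cs.simple s * u) := by
      obtain ⟨r, hr⟩ := cs.exists_rightDescent_of_ne_one (w := x) (by
        rintro rfl
        exact hxQ h1)
      have := cs.isRightDescent_iff.mp hr
      have := cs.length_mul_simple (cs.simple s * x) r
      rw [mul_assoc] at this
      exact ⟨_, mul_simple_bCov hr, by omega⟩
    obtain ⟨huQ, huP⟩ := hcx u hu
    have hul := hu.length_eq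
    have hus' := cs.length_simple_mul u s
    have hsuQ := hreg.1 u huQ
    have hfP := φ.toFun_mem_dihedral ha hsuQ (hsP u huP)
    have hfQ := φ.maps _ hsuQ
    have hfl : cs.length (φ.toFun (cs.simple s * u)) + 1 = cs.length (cs.simple s * u) := by
      have := hdown _ hfQ hfP
      have := φ.length_toFun hsuQ
      omega
    have hf : bCov cs (φ.toFun (cs.simple s * u)) x :=
      bCov_iff.mpr ⟨bruhatLE_of_mem_dihedral hfP hxP (by omega), by omega⟩
    refine hxQ (hmax.mem_of_insertPair (bCov_simple_mul hsx) (fun c hc => (hcx c hc).1) ?_ ?_ hsxQ)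
    · intro c hc
      obtain h | ⟨v, hv, -, rfl⟩ := (bCov_simple_mul_iff hsx).mp hc
      · exact Or.inl h
      · exact Or.inr (hreg.1 v (hcx v hv).1)
    · have hsux : cs.simple s * u = cs.wordProd (altW s a (k + 1)) :=
        huniq _ (hsP u huP) (by omega) fun h => hxQ (h ▸ hsuQ)
      intro c
      rw [bCov_simple_mul_iff hsx]
      refine or_congr_right ⟨?_, ?_⟩
      · rintro ⟨v, hv, hvs, rfl⟩
        obtain ⟨hvQ, hvP⟩ := hcx v hv
        have := hv.length_eq
        have := cs.length_simple_mul v s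
        refine ⟨_, hf, ?_, ?_⟩
        · rw [φ.invol _ hsuQ]
          exact φ.toFun_bCov hsuQ (by omega)
        · rw [φ.invol _ hsuQ, hsux]
          exact huniq _ (hsP v hvP) (by omega) fun h => hxQ (h ▸ hreg.1 v hvQ)
      · rintro ⟨v, hv, hvf, rfl⟩
        obtain ⟨hvQ, hvP⟩ := hcx v hv
        have := hv.length_eq
        have := hvf.length_eq
        refine ⟨u, hu, hus, ?_⟩
        rw [hsux]
        exact huniq _ (φ.toFun_mem_dihedral ha hvQ hvP) (by omega) fun h =>
          hxQ (h ▸ φ.maps v hvQ)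

end Regular

section Commute

variable {B : Type*} {W : Type*} [Group W] {M : CoxeterMatrix B} {cs : CoxeterSystem M W}
  {φ : BSM cs} {s a : B}

theorem BSM.simple_bruhatLE_toFun (ha : φ.toFun 1 = cs.simple a) {x : W} (hx : x ∈ φ.dom)
    (hxf : cs.length x < cs.length (φ.toFun x)) : bruhatLE cs (cs.simple a) (φ.toFun x) := by
  induction hn : cs.length x using Nat.strong_induction_on generalizing x with
  | _ n ih =>
    by_cases hx1 : x = 1
    · rw [hx1, ha]
      exact bruhatLE_refl _
    obtain ⟨i, hi⟩ := cs.exists_leftDescent_of_ne_one hx1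
    have hv := simple_mul_bCov hi
    generalize cs.simple i * x = v at hv
    have hvl := hv.length_eq
    have hvQ := φ.mem_of_bCov hx hv
    have hcov := φ.bCov_toFun hx hxf
    obtain h | h := φ.length_toFun hvQ
    · refine bruhatLE_trans (ih _ (by omega) hvQ (by omega) rfl) (bCov.le ?_)
      exact (φ.bCov_toFun_iff hx hcov).mpr (Or.inr ⟨v, hv, φ.bCov_toFun hvQ (by omega), rfl⟩)
    · have h1 := ih _ (by omega) (φ.maps v hvQ) (by rw [φ.invol v hvQ]; omega) rfl
      rw [φ.invol v hvQ] at h1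
      exact bruhatLE_trans h1 (bruhatLE_trans hv.le hcov.le)

/-- The coatoms of `s * φ x`, when `φ` commutes with `s` on the coatoms of `x`. -/
theorem BSM.bCov_simple_mul_toFun_iff {x : W} (hx : x ∈ φ.dom)
    (hxf : cs.length x < cs.length (φ.toFun x))
    (hxs : cs.length x < cs.length (cs.simple s * x)) (hne : φ.toFun x ≠ cs.simple s * x)
    (hcomm : ∀ u, bCov cs u x → cs.simple s * u ∈ φ.dom ∧
      φ.toFun (cs.simple s * u) = cs.simple s * φ.toFun u) :
    cs.length (φ.toFun x) < cs.length (cs.simple s * φ.toFun x) ∧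
      ∀ c, bCov cs c (cs.simple s * φ.toFun x) ↔ c = cs.simple s * x ∨
        ∃ v, bCov cs v (cs.simple s * x) ∧ bCov cs v (φ.toFun v) ∧ c = φ.toFun v := by
  have hcov := φ.bCov_toFun hx hxf
  have hwl := hcov.length_eq
  have hw : cs.length (φ.toFun x) < cs.length (cs.simple s * φ.toFun x) := by
    obtain h | h := cs.length_simple_mul (φ.toFun x) s
    · omega
    · have h1 := bruhatLE_simple_mul hcov.le (by omega) hxs
      have h2 := bruhatLE_eq_of_length_le h1 (by omega)
      exact absurd (by nth_rw 2 [h2]; rw [simple_mul_simple_cancel_left]) hne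
  refine ⟨hw, fun c => ?_⟩
  have hx' := cs.length_simple_mul x s
  rw [bCov_simple_mul_iff hw]
  constructor
  · rintro (rfl | ⟨u, hu, hus, rfl⟩)
    · exact Or.inr ⟨x, bCov_simple_mul hxs, hcov, rfl⟩
    · obtain rfl | ⟨v, hv, hvf, rfl⟩ := (φ.bCov_toFun_iff hx hcov).mp hu
      · exact Or.inl rfl
      · obtain ⟨hsv, he⟩ := hcomm v hv
        have h1 := hvf.length_eq
        have h2 := φ.length_toFun hsv
        have h3 := cs.length_simple_mul v s
        have h4 := cs.length_simple_mul (φ.toFun v) s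
        rw [he] at h2
        refine Or.inr ⟨cs.simple s * v, ?_, φ.bCov_toFun hsv (by rw [he]; omega), he.symm⟩
        exact (bCov_simple_mul_iff hxs).mpr (Or.inr ⟨v, hv, by omega, rfl⟩)
  · rintro (rfl | ⟨v, hv, hvf, rfl⟩)
    · exact Or.inr ⟨x, hcov, hxs, rfl⟩
    · obtain rfl | ⟨u, hu, hus, rfl⟩ := (bCov_simple_mul_iff hxs).mp hv
      · exact Or.inl rfl
      · obtain ⟨hsu, he⟩ := hcomm u hu
        have huQ := φ.mem_of_bCov hx hu
        have h1 := hvf.length_eq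
        have h2 := φ.length_toFun huQ
        have h3 := cs.length_simple_mul u s
        have h4 := cs.length_simple_mul (φ.toFun u) s
        rw [he] at h1
        refine Or.inr ⟨φ.toFun u, ?_, by omega, he⟩
        exact (φ.bCov_toFun_iff hx hcov).mpr
          (Or.inr ⟨u, hu, φ.bCov_toFun huQ (by omega), rfl⟩)

theorem BSM.toFun_simple_mul (ha : φ.toFun 1 = cs.simple a) (hs : s ≠ a)
    (hP : ∀ x ∈ dihedral cs s a, φ.toFun (cs.simple s * x) = cs.simple s * φ.toFun x)
    {x : W} (hx : x ∈ φ.dom) (hsx : cs.simple s * x ∈ φ.dom) :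
    φ.toFun (cs.simple s * x) = cs.simple s * φ.toFun x := by
  induction hn : cs.length x using Nat.strong_induction_on generalizing x with
  | _ n ih =>
    obtain hxs | hxs := (cs.length_simple_mul x s).symm
    · have h := ih _ (by omega) hsx (by rwa [simple_mul_simple_cancel_left]) rfl
      rw [simple_mul_simple_cancel_left] at h
      rw [h, simple_mul_simple_cancel_left]
    have hxs' : cs.length x < cs.length (cs.simple s * x) := by omega
    have hdown : ∀ u, bruhatLE cs u x → cs.simple s * u ∈ φ.dom := fun u hu =>
      φ.ideal hsx (simple_mul_bruhatLE_simple_mul hu hxs')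
    obtain hl | hl := (φ.length_toFun hx).symm
    · have hsy := hdown _ (φ.toFun_bCov hx (by omega)).le
      have h := ih _ (by omega) (φ.maps x hx) hsy rfl
      rw [φ.invol x hx] at h
      rw [← h, φ.invol _ hsy]
    by_cases hne : φ.toFun x = cs.simple s * x
    · rw [← hne, φ.invol x hx, hne, simple_mul_simple_cancel_left]
    have hxf := φ.bCov_toFun hx (by omega)
    obtain ⟨hw, hcoat⟩ := φ.bCov_simple_mul_toFun_iff hx (by omega) hxs' hne fun u hu => by
      have := hu.length_eq
      have hsu := hdown u hu.le
      exact ⟨hsu, ih _ (by omega) (φ.mem_of_bCov hx hu) hsu rfl⟩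
    have hz : bCov cs (cs.simple s * x) (φ.toFun (cs.simple s * x)) := by
      refine (φ.cov _ hsx).resolve_left fun hz => ?_
      have hzQ := φ.maps _ hsx
      have h := φ.bCov_toFun_iff (c := x) hzQ (by rwa [φ.invol _ hsx])
      rw [φ.invol _ hsx] at h
      obtain h | ⟨v, hv, hvf, h⟩ := h.mp (bCov_simple_mul hxs')
      · rw [h, φ.invol _ hsx] at hne
        exact hne (by rw [← h])
      · have h1 := hvf.length_eq
        rw [h, φ.invol v (φ.mem_of_bCov hzQ hv)] at hl
        omega
    by_contra hcon
    have h1 := hz.length_eq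
    have h2 := cs.length_simple_mul (φ.toFun x) s
    have hle := bruhatLE_simple_mul_self s hw
    obtain ⟨l, l', h⟩ := exists_altW_of_coatoms (cs := cs)
      (fun c => (hcoat c).trans (φ.bCov_toFun_iff hsx hz).symm) (Ne.symm hcon) (by omega)
    have hmem : ∀ {k}, bruhatLE cs (cs.simple k) (cs.simple s * φ.toFun x) → k = l ∨ k = l' := by
      intro k hk
      refine eq_or_eq_of_simple_mem_dihedral (mem_dihedral_of_bruhatLE hk ?_)
      rw [h]
      exact wordProd_mem_dihedral fun j hj => mem_altW hj
    have hsl := hmem (k := s) (by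
      simpa using simple_mul_bruhatLE_simple_mul (one_bruhatLE (φ.toFun x)) hw)
    have hal := hmem (bruhatLE_trans (φ.simple_bruhatLE_toFun ha hx (by omega)) hle)
    have hwP : cs.simple s * φ.toFun x ∈ dihedral cs s a := by
      rw [h]
      refine wordProd_mem_dihedral fun j hj => ?_
      have := mem_altW hj
      grind
    exact hcon (hP x (mem_dihedral_of_bruhatLE (bruhatLE_trans hxf.le hle) hwP))

theorem BMax.simple_mul_mem (hmax : BMax φ) (ha : φ.toFun 1 = cs.simple a) (hs : s ≠ a)
    (hP : ∀ x ∈ dihedral cs s a, φ.toFun (cs.simple s * x) = cs.simple s * φ.toFun x)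
    {x : W} (hx : x ∈ φ.dom) : cs.simple s * x ∈ φ.dom := by
  induction hn : cs.length x using Nat.strong_induction_on generalizing x with
  | _ n ih =>
    obtain hxs | hxs := (cs.length_simple_mul x s).symm
    · exact φ.ideal hx (simple_mul_bruhatLE_self s (by omega))
    have hxs' : cs.length x < cs.length (cs.simple s * x) := by omega
    by_contra hsx
    have hw := φ.maps x hx
    obtain hl | hl := (φ.length_toFun hx).symm
    · have hsw := ih _ (by omega) hw rfl
      have h := φ.toFun_simple_mul ha hs hP hw hsw
      rw [φ.invol x hx] at h
      exact hsx (h ▸ φ.maps _ hsw)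
    have hdown : ∀ u, bCov cs u x → cs.simple s * u ∈ φ.dom := fun u hu => by
      have := hu.length_eq
      exact ih _ (by omega) (φ.mem_of_bCov hx hu) rfl
    obtain ⟨-, hcoat⟩ := φ.bCov_simple_mul_toFun_iff hx (by omega) hxs'
      (fun h => hsx (h ▸ hw)) fun u hu =>
        ⟨hdown u hu, φ.toFun_simple_mul ha hs hP (φ.mem_of_bCov hx hu) (hdown u hu)⟩
    have hcov := (hcoat _).mpr (Or.inl rfl)
    have hcx : ∀ c, bCov cs c (cs.simple s * x) → c ∈ φ.dom := by
      intro c hc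
      obtain rfl | ⟨u, hu, -, rfl⟩ := (bCov_simple_mul_iff hxs').mp hc
      · exact hx
      · exact hdown u hu
    refine hsx (hmax.mem_of_insertPair hcov hcx (fun c hc => ?_) hcoat fun h =>
      hsx (φ.mem_of_bCov h hcov))
    refine ((hcoat c).mp hc).imp_right ?_
    rintro ⟨v, hv, -, rfl⟩
    exact φ.maps v (hcx v hv)

end Commute

/-- `φ` is `s`-regular on the left iff its restriction to the principal
dihedral subgroup `P_s = ⟨s,a⟩` is `s`-regular on the left. -/
theorem stmt11 {B : Type*} {W : Type*} [Group W] {M : CoxeterMatrix B}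
    (cs : CoxeterSystem M W) (φ : BSM cs) (hmax : BMax φ)
    (h1 : (1 : W) ∈ φ.dom) (a : B) (ha : φ.toFun 1 = cs.simple a)
    (s : B) (hs : s ≠ a) :
    LeftReg φ (cs.simple s) ↔
      ∀ x ∈ dihedral cs s a, cs.simple s * x ∈ φ.dom ∧
        φ.toFun (cs.simple s * x) = cs.simple s * φ.toFun x := by
  constructor
  · intro hreg x hx
    have hxQ := mem_dom_of_mem_dihedral hmax h1 ha hreg hx
    exact ⟨hreg.1 x hxQ, hreg.2 x hxQ⟩
  · intro h
    have hP := fun x hx => (h x hx).2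
    have hstab := fun x (hx : x ∈ φ.dom) => hmax.simple_mul_mem ha hs hP hx
    exact ⟨hstab, fun x hx => φ.toFun_simple_mul ha hs hP hx (hstab x hx)⟩
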